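/- Sp₊(k,ℓ) is a subgroup of Sp(k,ℓ), and the restriction ϖ₊ of ϖ to Sp₊(k,ℓ) is a surjective group homomorphism onto GL₊(k,ℝ) × Sp(ℓ−k) whose kernel equals T = ker(ϖ). -/

import Mathlib

open Matrix

/-- Half index type: `Fin k ⊕ Fin m` with `m = ℓ - k`. -/
abbrev HalfIdx (k m : ℕ) := Fin k ⊕ Fin m

/-- Full index type for `2ℓ × 2ℓ` matrices, in block form `(k, m, k, m)`. -/
abbrev FullIdx (k m : ℕ) := HalfIdx k m ⊕ HalfIdx k m

/-- The standard symplectic matrix `J = [[0, I], [-I, 0]]`. -/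
def Jmat (k m : ℕ) : Matrix (FullIdx k m) (FullIdx k m) ℝ :=
  Matrix.fromBlocks 0 1 (-1) 0

/-- The symplectic group `Sp(ℓ)`: matrices with `Mᵀ J M = J`. -/
def SpBig (k m : ℕ) : Set (Matrix (FullIdx k m) (FullIdx k m) ℝ) :=
  {M | Mᵀ * Jmat k m * M = Jmat k m}

def Jsmall (m : ℕ) : Matrix (Fin m ⊕ Fin m) (Fin m ⊕ Fin m) ℝ :=
  Matrix.fromBlocks 0 1 (-1) 0

/-- The symplectic group `Sp(ℓ-k)`. -/
def SpSmall (m : ℕ) : Set (Matrix (Fin m ⊕ Fin m) (Fin m ⊕ Fin m) ℝ) :=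
  {S | Sᵀ * Jsmall m * S = Jsmall m}

/-- Embedding of block indices `1..4` of sizes `k, m, k, m`. -/
def r1 (k m : ℕ) : Fin k → FullIdx k m := fun i => Sum.inl (Sum.inl i)
def r2 (k m : ℕ) : Fin m → FullIdx k m := fun i => Sum.inl (Sum.inr i)
def r3 (k m : ℕ) : Fin k → FullIdx k m := fun i => Sum.inr (Sum.inl i)
def r4 (k m : ℕ) : Fin m → FullIdx k m := fun i => Sum.inr (Sum.inr i)

/-- Embedding of the indices `{k+1,…,ℓ} ∪ {ℓ+k+1,…,2ℓ}`. -/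
def embSmall (k m : ℕ) : Fin m ⊕ Fin m → FullIdx k m :=
  Sum.elim (fun i => Sum.inl (Sum.inr i)) (fun i => Sum.inr (Sum.inr i))

/-- The upper-left `k × k` block `A₁`. -/
def blk1 (k m : ℕ) (M : Matrix (FullIdx k m) (FullIdx k m) ℝ) : Matrix (Fin k) (Fin k) ℝ :=
  M.submatrix (r1 k m) (r1 k m)

/-- The `2(ℓ-k) × 2(ℓ-k)` submatrix `A₂`. -/
def blk2 (k m : ℕ) (M : Matrix (FullIdx k m) (FullIdx k m) ℝ) :
    Matrix (Fin m ⊕ Fin m) (Fin m ⊕ Fin m) ℝ :=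
  M.submatrix (embSmall k m) (embSmall k m)

/-- `Sp(k,ℓ)`: symplectic matrices with `a_{ij} = 0` for `1 ≤ j ≤ k` and `i > k`. -/
def SpKL (k m : ℕ) : Set (Matrix (FullIdx k m) (FullIdx k m) ℝ) :=
  {M | M ∈ SpBig k m ∧
    ∀ (i : FullIdx k m) (j : Fin k), (∀ i' : Fin k, i ≠ r1 k m i') → M i (r1 k m j) = 0}

/-- The kernel `T` of `ϖ : Sp(k,ℓ) → GL(k,ℝ) × Sp(ℓ-k)`. -/
def kerVarpi (k m : ℕ) : Set (Matrix (FullIdx k m) (FullIdx k m) ℝ) :=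
  {M | M ∈ SpKL k m ∧ blk1 k m M = 1 ∧ blk2 k m M = 1}

/-- `Sp₊(k,ℓ)`: elements of `Sp(k,ℓ)` with `det A₁ > 0`. -/
def SpPlus (k m : ℕ) : Set (Matrix (FullIdx k m) (FullIdx k m) ℝ) :=
  {M | M ∈ SpKL k m ∧ 0 < (blk1 k m M).det}

/-- The kernel of `γ : Sp₊(k,ℓ) → Sp(ℓ-k)`, the second component of `ϖ`. -/
def kerGamma (k m : ℕ) : Set (Matrix (FullIdx k m) (FullIdx k m) ℝ) :=
  {M | M ∈ SpPlus k m ∧ blk2 k m M = 1}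

section SymplecticParabolic

variable {k m : ℕ} {M N : Matrix (FullIdx k m) (FullIdx k m) ℝ}

/-- The block form of a matrix preserving the flag spanned by the first block and its
symplectic complement. -/
def parabolic (A : Matrix (Fin k) (Fin k) ℝ) (B : Matrix (Fin k) (Fin m) ℝ)
    (C : Matrix (Fin k) (Fin k) ℝ) (D : Matrix (Fin k) (Fin m) ℝ)
    (E F : Matrix (Fin m) (Fin k) ℝ) (G : Matrix (Fin k) (Fin k) ℝ)
    (S : Matrix (Fin m ⊕ Fin m) (Fin m ⊕ Fin m) ℝ) : Matrix (FullIdx k m) (FullIdx k m) ℝ :=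
  fromBlocks (fromBlocks A B 0 S.toBlocks₁₁) (fromBlocks C D E S.toBlocks₁₂)
    (fromBlocks 0 0 0 S.toBlocks₂₁) (fromBlocks G 0 F S.toBlocks₂₂)

lemma blk1_parabolic (A : Matrix (Fin k) (Fin k) ℝ) (B : Matrix (Fin k) (Fin m) ℝ) C D E F G S :
    blk1 k m (parabolic A B C D E F G S) = A := by
  ext i j
  simp [blk1, parabolic, r1]

lemma blk2_parabolic (A : Matrix (Fin k) (Fin k) ℝ) (B : Matrix (Fin k) (Fin m) ℝ) C D E F G S :
    blk2 k m (parabolic A B C D E F G S) = S := by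
  ext (i | i) (j | j) <;>
    simp [blk2, parabolic, embSmall, toBlocks₁₁, toBlocks₁₂, toBlocks₂₁, toBlocks₂₂]

lemma parabolic_apply_r1 (A : Matrix (Fin k) (Fin k) ℝ) (B : Matrix (Fin k) (Fin m) ℝ) C D E F G S
    (i : FullIdx k m) (j : Fin k) (hi : ∀ i' : Fin k, i ≠ r1 k m i') :
    parabolic A B C D E F G S i (r1 k m j) = 0 := by
  rcases i with (i | i) | (i | i)
  · exact absurd rfl (hi i)
  all_goals simp [parabolic, r1]

lemma transpose_blk1_mul_of_mem_SpKL (hM : M ∈ SpKL k m) (i : Fin k) (j : FullIdx k m) :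
    ((blk1 k m M)ᵀ * M.submatrix (r3 k m) id) i j = Jmat k m (r1 k m i) j := by
  obtain ⟨hsp, h0⟩ := hM
  have h2 : ∀ a b, M (Sum.inl (Sum.inr a)) (Sum.inl (Sum.inl b)) = 0 :=
    fun a b => h0 _ b (by simp [r1])
  have h3 : ∀ a b, M (Sum.inr a) (Sum.inl (Sum.inl b)) = 0 :=
    fun a b => h0 _ b (by simp [r1])
  have hsp : Mᵀ * Jmat k m * M = Jmat k m := hsp
  have := congrFun (congrFun hsp (r1 k m i)) j
  rw [← this, Matrix.mul_assoc, mul_apply, mul_apply, Fintype.sum_sum_type,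
    Fintype.sum_sum_type]
  have hJ : ∀ a : Fin k, (Jmat k m * M) (Sum.inl (Sum.inl a)) j = M (r3 k m a) j := by
    intro a
    simp [Jmat, mul_apply, Fintype.sum_sum_type, one_apply, r3]
  simp [hJ, h2, h3, r1, blk1]

lemma apply_r3_of_mem_SpKL (hM : M ∈ SpKL k m) (i : Fin k) (j : FullIdx k m)
    (hj : ∀ j', j ≠ r3 k m j') : M (r3 k m i) j = 0 := by
  have h1 : (blk1 k m M)ᵀ * M.submatrix (r3 k m) (r3 k m) = 1 := by
    ext a b
    have := transpose_blk1_mul_of_mem_SpKL hM a (r3 k m b)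
    simpa [mul_apply, Jmat, r1, r3, one_apply] using this
  have h1' := mul_eq_one_comm.mp h1
  have hz : (blk1 k m M)ᵀ *ᵥ (fun a => M (r3 k m a) j) = 0 := by
    ext a
    refine (transpose_blk1_mul_of_mem_SpKL hM a j).trans ?_
    rcases j with (j | j) | (j | j)
    · simp [Jmat, r1]
    · simp [Jmat, r1]
    · exact absurd rfl (hj j)
    · simp [Jmat, r1]
  have := congrArg (fun v => M.submatrix (r3 k m) (r3 k m) *ᵥ v) hz
  simp only [mulVec_mulVec, h1', one_mulVec, mulVec_zero] at this
  exact congrFun this i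

lemma exists_eq_parabolic (hM : M ∈ SpKL k m) :
    ∃ A B C D E F G S, M = parabolic A B C D E F G S := by
  refine ⟨M.toBlocks₁₁.toBlocks₁₁, M.toBlocks₁₁.toBlocks₁₂, M.toBlocks₁₂.toBlocks₁₁,
    M.toBlocks₁₂.toBlocks₁₂, M.toBlocks₁₂.toBlocks₂₁, M.toBlocks₂₂.toBlocks₂₁,
    M.toBlocks₂₂.toBlocks₁₁, blk2 k m M, ?_⟩
  have h3 := apply_r3_of_mem_SpKL hM
  have h0 := hM.2
  ext ((i | i) | (i | i)) ((j | j) | (j | j)) <;>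
    simp only [parabolic, blk2, embSmall, fromBlocks_apply₁₁, fromBlocks_apply₁₂,
      fromBlocks_apply₂₁, fromBlocks_apply₂₂, toBlocks₁₁, toBlocks₁₂, toBlocks₂₁, toBlocks₂₂,
      of_apply, submatrix_apply, Sum.elim_inl, Sum.elim_inr, Matrix.zero_apply]
  · exact h0 _ j (by simp [r1])
  · exact h0 _ j (by simp [r1])
  · exact h3 i _ (by simp [r3])
  · exact h3 i _ (by simp [r3])
  · exact h0 _ j (by simp [r1])

lemma parabolic_mul (A : Matrix (Fin k) (Fin k) ℝ) (B : Matrix (Fin k) (Fin m) ℝ) C D E F G S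
    (A' : Matrix (Fin k) (Fin k) ℝ) (B' : Matrix (Fin k) (Fin m) ℝ) C' D' E' F' G' S' :
    ∃ B'' C'' D'' E'' F'' G'', parabolic A B C D E F G S * parabolic A' B' C' D' E' F' G' S' =
      parabolic (A * A') B'' C'' D'' E'' F'' G'' (S * S') := by
  refine ⟨A * B' + B * S'.toBlocks₁₁ + D * S'.toBlocks₂₁, A * C' + B * E' + (C * G' + D * F'),
    A * D' + B * S'.toBlocks₁₂ + D * S'.toBlocks₂₂, S.toBlocks₁₁ * E' + (E * G' + S.toBlocks₁₂ * F'),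
    S.toBlocks₂₁ * E' + (F * G' + S.toBlocks₂₂ * F'), G * G', ?_⟩
  have hS := fromBlocks_multiply S.toBlocks₁₁ S.toBlocks₁₂ S.toBlocks₂₁ S.toBlocks₂₂
    S'.toBlocks₁₁ S'.toBlocks₁₂ S'.toBlocks₂₁ S'.toBlocks₂₂
  rw [fromBlocks_toBlocks, fromBlocks_toBlocks] at hS
  simp only [parabolic, hS, fromBlocks_multiply, fromBlocks_add, toBlocks_fromBlocks₁₁,
    toBlocks_fromBlocks₁₂, toBlocks_fromBlocks₂₁, toBlocks_fromBlocks₂₂, Matrix.zero_mul,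
    Matrix.mul_zero, add_zero, zero_add]

lemma blk_mul (hM : M ∈ SpKL k m) (hN : N ∈ SpKL k m) :
    blk1 k m (M * N) = blk1 k m M * blk1 k m N ∧ blk2 k m (M * N) = blk2 k m M * blk2 k m N := by
  obtain ⟨A, B, C, D, E, F, G, S, rfl⟩ := exists_eq_parabolic hM
  obtain ⟨A', B', C', D', E', F', G', S', rfl⟩ := exists_eq_parabolic hN
  obtain ⟨_, _, _, _, _, _, h⟩ := parabolic_mul A B C D E F G S A' B' C' D' E' F' G' S'
  simp only [h, blk1_parabolic, blk2_parabolic, and_self]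

lemma SpBig_mul (hM : M ∈ SpBig k m) (hN : N ∈ SpBig k m) : M * N ∈ SpBig k m := by
  have hM : Mᵀ * Jmat k m * M = Jmat k m := hM
  have hN : Nᵀ * Jmat k m * N = Jmat k m := hN
  change (M * N)ᵀ * Jmat k m * (M * N) = Jmat k m
  calc (M * N)ᵀ * Jmat k m * (M * N) = Nᵀ * (Mᵀ * Jmat k m * M) * N := by
        simp only [transpose_mul, Matrix.mul_assoc]
    _ = Jmat k m := by rw [hM, hN]

lemma SpKL_mul (hM : M ∈ SpKL k m) (hN : N ∈ SpKL k m) : M * N ∈ SpKL k m := by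
  refine ⟨SpBig_mul hM.1 hN.1, ?_⟩
  obtain ⟨A, B, C, D, E, F, G, S, rfl⟩ := exists_eq_parabolic hM
  obtain ⟨A', B', C', D', E', F', G', S', rfl⟩ := exists_eq_parabolic hN
  obtain ⟨_, _, _, _, _, _, h⟩ := parabolic_mul A B C D E F G S A' B' C' D' E' F' G' S'
  rw [h]
  exact parabolic_apply_r1 _ _ _ _ _ _ _ _

lemma Jmat_mul_self : Jmat k m * Jmat k m = -1 := by
  simp [Jmat, fromBlocks_multiply, ← fromBlocks_one, fromBlocks_neg]

lemma exists_inverse_mem_SpKL (hM : M ∈ SpKL k m) : ∃ N ∈ SpKL k m, M * N = 1 ∧ N * M = 1 := by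
  have hsp : Mᵀ * Jmat k m * M = Jmat k m := hM.1
  have hl : (-(Jmat k m * Mᵀ * Jmat k m)) * M = 1 := by
    calc (-(Jmat k m * Mᵀ * Jmat k m)) * M = -(Jmat k m * (Mᵀ * Jmat k m * M)) := by
          simp only [Matrix.neg_mul, Matrix.mul_assoc]
      _ = 1 := by rw [hsp, Jmat_mul_self, neg_neg]
  have hr := mul_eq_one_comm.mp hl
  refine ⟨_, ⟨?_, ?_⟩, hr, hl⟩
  · generalize -(Jmat k m * Mᵀ * Jmat k m) = N at hr
    change Nᵀ * Jmat k m * N = Jmat k m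
    calc Nᵀ * Jmat k m * N = (M * N)ᵀ * Jmat k m * (M * N) := by
          conv_lhs => rw [← hsp]
          simp only [transpose_mul, Matrix.mul_assoc]
      _ = Jmat k m := by simp [hr]
  · obtain ⟨A, B, C, D, E, F, G, S, rfl⟩ := exists_eq_parabolic hM
    intro i j hi
    simp only [parabolic, Jmat, fromBlocks_transpose, fromBlocks_multiply, fromBlocks_neg]
    rcases i with (i | i) | (i | i)
    · exact absurd rfl (hi i)
    all_goals simp [r1]

lemma parabolic_mem_SpBig (A G : Matrix (Fin k) (Fin k) ℝ)
    (S : Matrix (Fin m ⊕ Fin m) (Fin m ⊕ Fin m) ℝ) (hAG : Aᵀ * G = 1) (hS : S ∈ SpSmall m) :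
    parabolic A 0 0 0 0 0 G S ∈ SpBig k m := by
  have hGA : Gᵀ * A = 1 := by simpa using congrArg transpose hAG
  have hS : Sᵀ * Jsmall m * S = Jsmall m := hS
  change (parabolic A 0 0 0 0 0 G S)ᵀ * Jmat k m * (parabolic A 0 0 0 0 0 G S) = Jmat k m
  rw [← fromBlocks_toBlocks S] at hS
  simp only [Jsmall, fromBlocks_transpose, fromBlocks_multiply, fromBlocks_inj, Matrix.mul_zero,
    Matrix.mul_one, Matrix.mul_neg, zero_add, add_zero, Matrix.neg_mul] at hS
  obtain ⟨h1, h2, h3, h4⟩ := hS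
  simp only [parabolic, Jmat, fromBlocks_transpose, fromBlocks_multiply,
    Matrix.mul_zero, Matrix.mul_one, Matrix.mul_neg, zero_add, add_zero, Matrix.neg_mul,
    fromBlocks_neg, fromBlocks_add, transpose_zero, Matrix.zero_mul, neg_zero, hAG, hGA,
    h1, h2, h3, h4, fromBlocks_zero, ← fromBlocks_one]

lemma blk2_mem_SpSmall (hM : M ∈ SpKL k m) : blk2 k m M ∈ SpSmall m := by
  have hsp : Mᵀ * Jmat k m * M = Jmat k m := hM.1
  obtain ⟨A, B, C, D, E, F, G, S, rfl⟩ := exists_eq_parabolic hM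
  rw [blk2_parabolic]
  have h := congrArg (blk2 k m) hsp
  have hJ : blk2 k m (Jmat k m) = Jsmall m := by
    ext (i | i) (j | j) <;> simp [blk2, embSmall, Jmat, Jsmall, one_apply]
  rw [hJ] at h
  change Sᵀ * Jsmall m * S = Jsmall m
  refine Eq.trans ?_ h
  conv_lhs => rw [← fromBlocks_toBlocks S]
  simp only [parabolic, Jmat, Jsmall, fromBlocks_transpose, fromBlocks_multiply,
    Matrix.mul_zero, Matrix.mul_one, Matrix.mul_neg, zero_add, add_zero, Matrix.neg_mul,
    fromBlocks_neg, fromBlocks_add, transpose_zero, Matrix.zero_mul, neg_zero]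
  ext (i | i) (j | j) <;> simp [blk2, embSmall]

lemma one_mem_SpKL : (1 : Matrix (FullIdx k m) (FullIdx k m) ℝ) ∈ SpKL k m := by
  refine ⟨?_, fun i j hi => one_apply_ne (hi j)⟩
  change 1ᵀ * Jmat k m * 1 = Jmat k m
  simp

lemma blk1_one : blk1 k m 1 = 1 :=
  submatrix_one _ fun _ _ h => by simpa [r1] using h

end SymplecticParabolic

/-- `Sp₊(k,ℓ)` is a subgroup of `Sp(k,ℓ)`, and the restriction
`ϖ₊` of `ϖ` to it is a surjective group homomorphism onto `GL₊(k,ℝ) × Sp(ℓ-k)`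
whose kernel equals `T = ker(ϖ)`. -/
theorem stmt4 (k m : ℕ) (hk : 1 ≤ k) :
    ((1 : Matrix (FullIdx k m) (FullIdx k m) ℝ) ∈ SpPlus k m) ∧
    (∀ M ∈ SpPlus k m, ∀ N ∈ SpPlus k m, M * N ∈ SpPlus k m) ∧
    (∀ M ∈ SpPlus k m, ∃ N ∈ SpPlus k m, M * N = 1 ∧ N * M = 1) ∧
    (∀ M ∈ SpPlus k m, 0 < (blk1 k m M).det ∧ blk2 k m M ∈ SpSmall m) ∧
    (∀ M ∈ SpPlus k m, ∀ N ∈ SpPlus k m,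
      blk1 k m (M * N) = blk1 k m M * blk1 k m N ∧
      blk2 k m (M * N) = blk2 k m M * blk2 k m N) ∧
    (∀ (A : Matrix (Fin k) (Fin k) ℝ) (S : Matrix (Fin m ⊕ Fin m) (Fin m ⊕ Fin m) ℝ),
      0 < A.det → S ∈ SpSmall m →
      ∃ M ∈ SpPlus k m, blk1 k m M = A ∧ blk2 k m M = S) ∧
    ({M | M ∈ SpPlus k m ∧ blk1 k m M = 1 ∧ blk2 k m M = 1} = kerVarpi k m) := by
  refine ⟨⟨one_mem_SpKL, by simp [blk1_one]⟩, fun M hM N hN => ⟨SpKL_mul hM.1 hN.1, ?_⟩,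
    fun M hM => ?_, fun M hM => ⟨hM.2, blk2_mem_SpSmall hM.1⟩,
    fun M hM N hN => blk_mul hM.1 hN.1, fun A S hA hS => ?_, ?_⟩
  · rw [(blk_mul hM.1 hN.1).1, det_mul]
    exact mul_pos hM.2 hN.2
  · obtain ⟨N, hN, hr, hl⟩ := exists_inverse_mem_SpKL hM.1
    refine ⟨N, ⟨hN, ?_⟩, hr, hl⟩
    have h := congrArg det (blk_mul hM.1 hN).1
    rw [hr, blk1_one, det_one, det_mul] at h
    exact pos_of_mul_pos_right (h ▸ one_pos) hM.2.le
  · have hAG : Aᵀ * (Aᵀ)⁻¹ = 1 := mul_nonsing_inv _ (by simpa using hA.ne')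
    exact ⟨parabolic A 0 0 0 0 0 (Aᵀ)⁻¹ S,
      ⟨⟨parabolic_mem_SpBig A _ S hAG hS, parabolic_apply_r1 _ _ _ _ _ _ _ _⟩,
        by rwa [blk1_parabolic]⟩, blk1_parabolic _ _ _ _ _ _ _ _, blk2_parabolic _ _ _ _ _ _ _ _⟩
  · ext M
    exact ⟨fun h => ⟨h.1.1, h.2⟩, fun h => ⟨⟨h.1, by simp [h.2.1]⟩, h.2⟩⟩
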